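/- arXiv:1706.00880 — 2 statements merged into one kernel-verified Lean document; each statement's English description precedes it below -/
import Mathlib

section
/- Consider an oriented graph on n nodes and m arcs with oriented incidence matrix 𝔍. If the graph is connected, then the rank of 𝔍 as a real matrix equals n − 1. -/
/-- The oriented incidence matrix of an oriented graph given by `tail, head`. -/
def incMat (n m : ℕ) (tail head : Fin m → Fin n) : Matrix (Fin n) (Fin m) ℝ :=
  Matrix.of fun i j => if i = tail j then 1 else if i = head j then -1 else 0

/-- The oriented graph is connected: every pair of nodes is related by the
reflexive–transitive closure of "there is an arc between them". -/
def GraphConnected (n m : ℕ) (tail head : Fin m → Fin n) : Prop :=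
  ∀ a b : Fin n, Relation.ReflTransGen
    (fun p q => ∃ j : Fin m, (tail j = p ∧ head j = q) ∨ (tail j = q ∧ head j = p)) a b

lemma incMat_transpose_mulVec_apply {n m : ℕ} {tail head : Fin m → Fin n} (x : Fin n → ℝ)
    {j : Fin m} (hj : tail j ≠ head j) :
    ((incMat n m tail head).transpose.mulVec x) j = x (tail j) - x (head j) := by
  have hentry : ∀ i, incMat n m tail head i j =
      (if i = tail j then (1 : ℝ) else 0) - (if i = head j then 1 else 0) := by
    intro i
    by_cases hi : i = tail j
    · subst hi
      simp [incMat, hj]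
    · simp only [incMat, Matrix.of_apply, hi, if_false]
      split_ifs <;> norm_num
  simp [Matrix.mulVec, dotProduct, hentry, sub_mul, Finset.sum_sub_distrib]

/-- The left kernel of the incidence matrix of a connected oriented graph consists of the constant
vectors. -/
lemma ker_incMat_transpose_of_connected {n m : ℕ} {tail head : Fin m → Fin n}
    (hth : ∀ j, tail j ≠ head j) (hconn : GraphConnected n m tail head) :
    LinearMap.ker (incMat n m tail head).transpose.mulVecLin = ℝ ∙ (1 : Fin n → ℝ) := by
  ext x
  rw [LinearMap.mem_ker, Submodule.mem_span_singleton, Matrix.mulVecLin_apply]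
  constructor
  · intro hx
    have harc : ∀ j, x (tail j) = x (head j) := fun j => by
      have h := congrFun hx j
      rw [incMat_transpose_mulVec_apply x (hth j)] at h
      exact sub_eq_zero.mp h
    have hconst : ∀ a b, x a = x b := fun a b => by
      induction hconn a b with
      | refl => rfl
      | tail _ hstep ih =>
        obtain ⟨j, ⟨rfl, rfl⟩ | ⟨rfl, rfl⟩⟩ := hstep
        · exact ih.trans (harc j)
        · exact ih.trans (harc j).symm
    rcases isEmpty_or_nonempty (Fin n) with _ | ⟨⟨a⟩⟩
    · exact ⟨0, Subsingleton.elim _ _⟩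
    · exact ⟨x a, funext fun b => by simp [hconst a b]⟩
  · rintro ⟨c, rfl⟩
    ext j
    simp [incMat_transpose_mulVec_apply _ (hth j)]

/-- the oriented incidence matrix of a connected oriented graph on
`n` nodes has rank `n − 1`. -/
theorem incidence_rank_of_connected
    (n m : ℕ) (hn : 1 ≤ n) (hm : 1 ≤ m)
    (tail head : Fin m → Fin n) (hth : ∀ j : Fin m, tail j ≠ head j)
    (hconn : GraphConnected n m tail head) :
    (incMat n m tail head).rank = n - 1 := by
  have : Nonempty (Fin n) := ⟨⟨0, hn⟩⟩
  have hrank := (incMat n m tail head).transpose.mulVecLin.finrank_range_add_finrank_ker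
  rw [ker_incMat_transpose_of_connected hth hconn, finrank_span_singleton one_ne_zero,
    Module.finrank_fin_fun] at hrank
  rw [← Matrix.rank_transpose, Matrix.rank]
  lia
end

section
/- Consider a connected oriented graph on n nodes (n ≥ 2) and m arcs with oriented incidence matrix 𝔍, and set μ = m − n + 1. Let B be a real μ×m matrix (an oriented fundamental cycle basis matrix) satisfying 𝔍·Bᵀ = 0 and rank B = μ. Then the range of the linear map z ↦ Bᵀ·z from ℝ^μ to ℝ^m equals the kernel of the linear map x ↦ 𝔍·x; that is, the columns of Bᵀ span the null space of the oriented incidence matrix. -/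
theorem transpose_incMat_mulVec_apply {n m : ℕ} {tail head : Fin m → Fin n}
    (hth : ∀ j : Fin m, tail j ≠ head j) (y : Fin n → ℝ) (j : Fin m) :
    ((incMat n m tail head).transpose.mulVec y) j = y (tail j) - y (head j) := by
  have hsplit : ∀ i : Fin n, incMat n m tail head i j * y i =
      (if i = tail j then y i else 0) - (if i = head j then y i else 0) := by
    intro i
    have hj := (hth j).symm
    simp only [incMat, Matrix.of_apply]
    split_ifs <;> grind
  simp only [Matrix.mulVec, dotProduct, Matrix.transpose_apply, hsplit,
    Finset.sum_sub_distrib, Finset.sum_ite_eq', Finset.mem_univ, if_true]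

theorem GraphConnected.eq_of_transpose_incMat_mulVec_eq_zero {n m : ℕ}
    {tail head : Fin m → Fin n} (hth : ∀ j : Fin m, tail j ≠ head j)
    (hconn : GraphConnected n m tail head) {y : Fin n → ℝ}
    (hy : (incMat n m tail head).transpose.mulVec y = 0) (a b : Fin n) : y a = y b := by
  have harc : ∀ j, y (tail j) = y (head j) := fun j => by
    have h := transpose_incMat_mulVec_apply hth y j
    rw [hy, Pi.zero_apply] at h
    linarith
  induction hconn a b with
  | refl => rfl
  | tail _ hstep ih =>
    obtain ⟨j, ⟨rfl, rfl⟩ | ⟨rfl, rfl⟩⟩ := hstep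
    · exact ih.trans (harc j)
    · exact ih.trans (harc j).symm

theorem GraphConnected.le_rank_incMat_add_one {n m : ℕ}
    {tail head : Fin m → Fin n} (hth : ∀ j : Fin m, tail j ≠ head j)
    (hconn : GraphConnected n m tail head) : n ≤ (incMat n m tail head).rank + 1 := by
  have hker : LinearMap.ker (incMat n m tail head).transpose.mulVecLin ≤
      Submodule.span ℝ {fun _ => (1 : ℝ)} := by
    intro y hy
    rw [LinearMap.mem_ker, Matrix.mulVecLin_apply] at hy
    rw [Submodule.mem_span_singleton]
    rcases isEmpty_or_nonempty (Fin n) with _ | ⟨⟨a⟩⟩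
    · exact ⟨0, Subsingleton.elim _ _⟩
    · refine ⟨y a, funext fun b => ?_⟩
      simpa using hconn.eq_of_transpose_incMat_mulVec_eq_zero hth hy a b
  have hle := (Submodule.finrank_mono hker).trans (finrank_span_le_card _)
  rw [Set.toFinset_singleton, Finset.card_singleton] at hle
  have hrn := (incMat n m tail head).transpose.mulVecLin.finrank_range_add_finrank_ker
  rw [Module.finrank_fin_fun, ← Matrix.rank, Matrix.rank_transpose] at hrn
  omega

/-- for a connected oriented graph (n ≥ 2) with `μ = m − n + 1`, if `B`
is a `μ×m` matrix with `𝔍·Bᵀ = 0` and `rank B = μ`, then the columns of `Bᵀ` span the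
null space of `𝔍`: the range of `z ↦ Bᵀ·z` equals the kernel of `x ↦ 𝔍·x`. -/
theorem cycle_basis_range_eq_ker_incidence
    (n m : ℕ) (hn : 2 ≤ n) (hm : 1 ≤ m)
    (tail head : Fin m → Fin n) (hth : ∀ j : Fin m, tail j ≠ head j)
    (hconn : GraphConnected n m tail head)
    (μ : ℕ) (hμ : μ = m - n + 1)
    (B : Matrix (Fin μ) (Fin m) ℝ)
    (hB : incMat n m tail head * B.transpose = 0)
    (hrank : B.rank = μ) :
    LinearMap.range B.transpose.mulVecLin =
      LinearMap.ker (incMat n m tail head).mulVecLin := by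
  have hn_le := hconn.le_rank_incMat_add_one hth
  have hrn := (incMat n m tail head).mulVecLin.finrank_range_add_finrank_ker
  rw [Module.finrank_fin_fun, ← Matrix.rank] at hrn
  apply Submodule.eq_of_le_of_finrank_le
  · rw [LinearMap.range_le_ker_iff, ← Matrix.mulVecLin_mul, hB, Matrix.mulVecLin_zero]
  · rw [← Matrix.rank, Matrix.rank_transpose, hrank]
    omega
end
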